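/- If 𝕊₁ and 𝕊₂ are two entropy functions on the set 𝒰 of uniform eidostates (each additive, order-characterizing on possible processes, vanishing on mechanical states, and equal to log₂|I| on information states I), then they determine the same entropic probabilities: for every uniform eidostate E and every state a ∈ E, 2^{𝕊₁(a) − 𝕊₁(E)} = 2^{𝕊₂(a) − 𝕊₂(E)}. -/

import Mathlib

structure EidoSys where
  State : Type
  [decEq : DecidableEq State]
  Eido : Set (Finset State)
  pair : State → State → State
  Sim : Finset State → Finset State → Prop
  Arrow : Finset State → Finset State → Prop
  pair_inj : ∀ a b a' b', pair a b = pair a' b' → a = a' ∧ b = b'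
  eido_nonempty : ∀ A ∈ Eido, A.Nonempty
  singleton_mem : ∀ a : State, ({a} : Finset State) ∈ Eido
  comb_mem : ∀ A B : Finset State, Finset.image₂ pair A B ∈ Eido ↔ A ∈ Eido ∧ B ∈ Eido
  subset_mem : ∀ A B : Finset State, A ∈ Eido → B ⊆ A → B.Nonempty → B ∈ Eido
  sim_refl : ∀ A : Finset State, Sim A A
  sim_symm : ∀ A B : Finset State, Sim A B → Sim B A
  sim_trans : ∀ A B C : Finset State, Sim A B → Sim B C → Sim A C
  sim_comm : ∀ A B : Finset State, Sim (Finset.image₂ pair A B) (Finset.image₂ pair B A)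
  sim_assoc : ∀ A B C : Finset State,
    Sim (Finset.image₂ pair (Finset.image₂ pair A B) C) (Finset.image₂ pair A (Finset.image₂ pair B C))
  sim_congr : ∀ A B C : Finset State, Sim A B → Sim (Finset.image₂ pair A C) (Finset.image₂ pair B C)
  arrow_of_sim : ∀ A B : Finset State, A ∈ Eido → B ∈ Eido → Sim A B → Arrow A B
  arrow_trans : ∀ A B C : Finset State, Arrow A B → Arrow B C → Arrow A C
  arrow_comb : ∀ A B C : Finset State, Arrow A B → Arrow (Finset.image₂ pair A C) (Finset.image₂ pair B C)
  arrow_cancel : ∀ (A B : Finset State) (s : State),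
    Arrow (Finset.image₂ pair A {s}) (Finset.image₂ pair B {s}) → Arrow A B
  arrow_nsubset : ∀ A B : Finset State, A ∈ Eido → B ∈ Eido → B ⊂ A → ¬ Arrow A B
  arrow_subset_single : ∀ (A A' : Finset State) (b : State),
    A ∈ Eido → A' ⊆ A → A'.Nonempty → Arrow A {b} → Arrow A' {b}
  arrow_union : ∀ A₁ A₂ B₁ B₂ : Finset State,
    A₁ ∈ Eido → A₂ ∈ Eido → B₁ ∈ Eido → B₂ ∈ Eido →
    Disjoint A₁ A₂ → Disjoint B₁ B₂ →
    (∀ a ∈ A₁ ∪ A₂, ∀ b ∈ A₁ ∪ A₂, Arrow {a} {b} ∨ Arrow {b} {a}) →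
    (∀ a ∈ B₁ ∪ B₂, ∀ b ∈ B₁ ∪ B₂, Arrow {a} {b} ∨ Arrow {b} {a}) →
    Arrow A₁ B₁ → Arrow A₂ B₂ → Arrow (A₁ ∪ A₂) (B₁ ∪ B₂)

attribute [instance] EidoSys.decEq

namespace EidoSys

variable (S : EidoSys)

/-- Combination of eidostates: the Cartesian product, realized via the pairing map. -/
def comb (A B : Finset S.State) : Finset S.State := Finset.image₂ S.pair A B

/-- The process (A,B) is possible: A ⇌ B. -/
def Pos (A B : Finset S.State) : Prop := S.Arrow A B ∨ S.Arrow B A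

/-- A ↔ B. -/
def Rev (A B : Finset S.State) : Prop := S.Arrow A B ∧ S.Arrow B A

/-- Uniform eidostate. -/
def Uniform (A : Finset S.State) : Prop := A ∈ S.Eido ∧ ∀ a ∈ A, ∀ b ∈ A, S.Pos {a} {b}

/-- Record state: a ↔ a + r for some state a. -/
def IsRecord (r : S.State) : Prop := ∃ a : S.State, S.Rev {a} (S.comb {a} {r})

/-- Information state: an eidostate all of whose elements are record states. -/
def IsInfo (I : Finset S.State) : Prop := I ∈ S.Eido ∧ ∀ r ∈ I, S.IsRecord r

/-- Bit state: an information state with exactly two elements. -/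
def IsBit (I : Finset S.State) : Prop := S.IsInfo I ∧ I.card = 2

/-- Information axiom: there exist a bit state and a possible bit process. -/
def InfoAxiom : Prop := ∃ (r : S.State) (I : Finset S.State), S.IsRecord r ∧ S.IsBit I ∧ S.Pos {r} I

/-- Demon axiom. -/
def DemonAxiom : Prop := ∀ a b : S.State, ∀ J : Finset S.State, S.IsInfo J →
    S.Arrow {a} (S.comb {b} J) →
    (∃ I : Finset S.State, S.IsInfo I ∧ S.Arrow {b} (S.comb {a} I)) ∧
    (∀ I : Finset S.State, S.IsInfo I → S.Arrow {a} (S.comb {b} I) ∨ S.Arrow (S.comb {b} I) {a})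

/-- `copies A n` is the combination of `n+1` copies of `A` (so `copies A 0 = A`). -/
def copies (A : Finset S.State) : ℕ → Finset S.State
  | 0 => A
  | n + 1 => S.comb A (copies A n)

/-- Stability axiom: if nA → nB + J for arbitrarily large n, then A → B. -/
def StabilityAxiom : Prop := ∀ A B J : Finset S.State, A ∈ S.Eido → B ∈ S.Eido → S.IsInfo J →
    (∀ N : ℕ, ∃ n ≥ N, S.Arrow (S.copies A n) (S.comb (S.copies B n) J)) → S.Arrow A B

/-- State-equivalence axiom. -/
def StateEquivAxiom : Prop := ∀ E : Finset S.State, S.Uniform E →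
    ∃ e x y : S.State, S.Arrow {x} {y} ∧ S.Rev (S.comb E {x}) (S.comb {e} {y})

/-- `addCopies A B k` is A + k·B (k copies of B appended to A). -/
def addCopies (A B : Finset S.State) : ℕ → Finset S.State
  | 0 => A
  | k + 1 => S.comb (addCopies A B k) B

/-- A designated set of mechanical states. -/
def MechSet (M : Set S.State) : Prop :=
  (∀ l ∈ M, ∀ m ∈ M, S.pair l m ∈ M) ∧
  (∀ l ∈ M, ∀ m ∈ M, S.Arrow {l} {m} → S.Arrow {m} {l})

/-- Component of content on uniform eidostates. -/
def IsCoCU (Q : Finset S.State → ℝ) : Prop :=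
  (∀ E F : Finset S.State, S.Uniform E → S.Uniform F → Q (S.comb E F) = Q E + Q F) ∧
  (∀ E F : Finset S.State, S.Uniform E → S.Uniform F → S.Pos E F → Q E = Q F)

/-- Entropy function on the uniform eidostates (relative to mechanical states M). -/
def IsEntropyU (M : Set S.State) (Ent : Finset S.State → ℝ) : Prop :=
  (∀ E F : Finset S.State, S.Uniform E → S.Uniform F → Ent (S.comb E F) = Ent E + Ent F) ∧
  (∀ E F : Finset S.State, S.Uniform E → S.Uniform F → S.Pos E F → (S.Arrow E F ↔ Ent E ≤ Ent F)) ∧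
  (∀ m ∈ M, Ent {m} = 0) ∧
  (∀ I : Finset S.State, S.IsInfo I → Ent I = Real.logb 2 (I.card))

end EidoSys

namespace EidoSys

variable {S : EidoSys}

theorem comb_singleton (a b : S.State) : S.comb {a} {b} = {S.pair a b} := by
  simp [comb]

theorem comb_mem_eido {A B : Finset S.State} (hA : A ∈ S.Eido) (hB : B ∈ S.Eido) :
    S.comb A B ∈ S.Eido :=
  (S.comb_mem A B).2 ⟨hA, hB⟩

theorem uniform_singleton (a : S.State) : S.Uniform {a} := by
  refine ⟨S.singleton_mem a, fun x hx y hy => Or.inl ?_⟩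
  rw [Finset.mem_singleton.1 hx, Finset.mem_singleton.1 hy]
  exact S.arrow_of_sim _ _ (S.singleton_mem a) (S.singleton_mem a) (S.sim_refl _)

theorem arrow_comb_comm {A B : Finset S.State} (hA : A ∈ S.Eido) (hB : B ∈ S.Eido) :
    S.Arrow (S.comb A B) (S.comb B A) :=
  S.arrow_of_sim _ _ (comb_mem_eido hA hB) (comb_mem_eido hB hA) (S.sim_comm A B)

theorem arrow_pair_left {a b : S.State} (h : S.Arrow {a} {b}) (c : S.State) :
    S.Arrow {S.pair a c} {S.pair b c} := by
  simpa using S.arrow_comb _ _ {c} h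

theorem arrow_pair_comm (a b : S.State) : S.Arrow {S.pair a b} {S.pair b a} := by
  simpa only [comb_singleton] using arrow_comb_comm (S.singleton_mem a) (S.singleton_mem b)

theorem arrow_pair {a b c d : S.State} (h : S.Arrow {a} {b}) (h' : S.Arrow {c} {d}) :
    S.Arrow {S.pair a c} {S.pair b d} :=
  S.arrow_trans _ _ _ (arrow_pair_left h c) <|
    S.arrow_trans _ _ _ (arrow_pair_comm b c) <|
      S.arrow_trans _ _ _ (arrow_pair_left h' b) (arrow_pair_comm d b)

theorem sim_pair_assoc (a b c : S.State) :
    S.Sim {S.pair (S.pair a b) c} {S.pair a (S.pair b c)} := by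
  simpa using S.sim_assoc {a} {b} {c}

theorem sim_pair_comm (a b : S.State) : S.Sim {S.pair a b} {S.pair b a} := by
  simpa using S.sim_comm {a} {b}

theorem sim_pair_left {a b : S.State} (h : S.Sim {a} {b}) (c : S.State) :
    S.Sim {S.pair a c} {S.pair b c} := by
  simpa using S.sim_congr _ _ {c} h

theorem sim_pair_pair_rotate (a r b : S.State) :
    S.Sim {S.pair (S.pair a r) b} {S.pair (S.pair b r) a} :=
  S.sim_trans _ _ _ (sim_pair_assoc a r b) <|
    S.sim_trans _ _ _ (sim_pair_comm a _) (sim_pair_left (sim_pair_comm r b) a)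

theorem arrow_of_sim_singleton {a b : S.State} (h : S.Sim {a} {b}) : S.Arrow {a} {b} :=
  S.arrow_of_sim _ _ (S.singleton_mem a) (S.singleton_mem b) h

theorem arrow_cancel_pair {a b : S.State} (s : S.State)
    (h : S.Arrow {S.pair a s} {S.pair b s}) : S.Arrow {a} {b} :=
  S.arrow_cancel _ _ s (by simpa using h)

/-- A record state can be appended to, or dropped from, any state. -/
theorem IsRecord.rev_pair {r : S.State} (hr : S.IsRecord r) (b : S.State) :
    S.Rev {b} {S.pair b r} := by
  obtain ⟨a, h, h'⟩ := hr
  rw [comb_singleton] at h h'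
  have hsim := sim_pair_pair_rotate a r b
  constructor
  · exact arrow_cancel_pair a <| S.arrow_trans _ _ _ (arrow_pair_comm b a) <|
      S.arrow_trans _ _ _ (arrow_pair_left h b) (arrow_of_sim_singleton hsim)
  · exact arrow_cancel_pair a <|
      S.arrow_trans _ _ _ (arrow_of_sim_singleton (S.sim_symm _ _ hsim)) <|
        S.arrow_trans _ _ _ (arrow_pair_left h' b) (arrow_pair_comm a b)

theorem IsRecord.pair {r s : S.State} (hr : S.IsRecord r) (hs : S.IsRecord s) :
    S.IsRecord (S.pair r s) := by
  refine ⟨r, ?_⟩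
  rw [comb_singleton]
  have h₁ := hr.rev_pair r
  have h₂ := hs.rev_pair (S.pair r r)
  have hsim := sim_pair_assoc r r s
  exact ⟨S.arrow_trans _ _ _ h₁.1 (S.arrow_trans _ _ _ h₂.1 (arrow_of_sim_singleton hsim)),
    S.arrow_trans _ _ _ (arrow_of_sim_singleton (S.sim_symm _ _ hsim))
      (S.arrow_trans _ _ _ h₂.2 h₁.2)⟩

theorem isInfo_singleton {r : S.State} (hr : S.IsRecord r) : S.IsInfo {r} :=
  ⟨S.singleton_mem r, fun _ hs => Finset.mem_singleton.1 hs ▸ hr⟩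

theorem IsInfo.comb {I J : Finset S.State} (hI : S.IsInfo I) (hJ : S.IsInfo J) :
    S.IsInfo (S.comb I J) := by
  refine ⟨comb_mem_eido hI.1 hJ.1, fun t ht => ?_⟩
  obtain ⟨r, hr, s, hs, rfl⟩ := Finset.mem_image₂.1 ht
  exact (hI.2 r hr).pair (hJ.2 s hs)

theorem card_comb (A B : Finset S.State) : (S.comb A B).card = A.card * B.card :=
  Finset.card_image₂ (fun _ _ _ _ h => S.pair_inj _ _ _ _ h) A B

theorem IsBit.exists_isInfo_card {I : Finset S.State} (hI : S.IsBit I) (k : ℕ) :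
    ∃ J, S.IsInfo J ∧ J.card = 2 ^ (k + 1) := by
  induction k with
  | zero => exact ⟨I, hI.1, hI.2⟩
  | succ k ih =>
    obtain ⟨J, hJ, hcard⟩ := ih
    exact ⟨S.comb J I, hJ.comb hI.1, by rw [card_comb, hcard, hI.2, ← pow_succ]⟩

theorem IsInfo.uniform_comb {I : Finset S.State} (hI : S.IsInfo I) (b : S.State) :
    S.Uniform (S.comb {b} I) := by
  refine ⟨comb_mem_eido (S.singleton_mem b) hI.1, fun x hx y hy => Or.inl ?_⟩
  simp only [EidoSys.comb, Finset.image₂_singleton_left, Finset.mem_image] at hx hy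
  obtain ⟨r, hr, rfl⟩ := hx
  obtain ⟨s, hs, rfl⟩ := hy
  exact S.arrow_trans _ _ _ ((hI.2 r hr).rev_pair b).2 ((hI.2 s hs).rev_pair b).1

theorem IsInfo.uniform {I : Finset S.State} (hI : S.IsInfo I) : S.Uniform I := by
  refine ⟨hI.1, fun r hr s hs => Or.inl ?_⟩
  exact S.arrow_trans _ _ _ ((hI.2 s hs).rev_pair r).1 <|
    S.arrow_trans _ _ _ (arrow_pair_comm r s) ((hI.2 r hr).rev_pair s).2

theorem Uniform.comb_state {E : Finset S.State} (hE : S.Uniform E) (x : S.State) :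
    S.Uniform (S.comb E {x}) := by
  refine ⟨comb_mem_eido hE.1 (S.singleton_mem x), fun a ha b hb => ?_⟩
  simp only [comb, Finset.image₂_singleton_right, Finset.mem_image] at ha hb
  obtain ⟨a, ha, rfl⟩ := ha
  obtain ⟨b, hb, rfl⟩ := hb
  exact (hE.2 a ha b hb).imp (arrow_pair_left · x) (arrow_pair_left · x)

/-- `statePow a n` is the combination of `n + 1` copies of the state `a`. -/
def statePow (a : S.State) : ℕ → S.State
  | 0 => a
  | n + 1 => S.pair a (statePow a n)

theorem arrow_statePow {a b : S.State} (h : S.Arrow {a} {b}) (n : ℕ) :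
    S.Arrow {statePow a n} {statePow b n} := by
  induction n with
  | zero => exact h
  | succ n ih => exact arrow_pair h ih

/-- If `a → b`, then every process between `b` and `a` with an information state appended
is possible. -/
theorem DemonAxiom.pos_comb_of_arrow (hdemon : S.DemonAxiom) {r : S.State} (hr : S.IsRecord r)
    {a b : S.State} (h : S.Arrow {a} {b}) {I : Finset S.State} (hI : S.IsInfo I) :
    S.Pos {b} (S.comb {a} I) := by
  have hab : S.Arrow {a} (S.comb {b} {r}) := by
    rw [comb_singleton]
    exact S.arrow_trans _ _ _ h (hr.rev_pair b).1
  obtain ⟨J, hJ, hba⟩ := (hdemon a b {r} (isInfo_singleton hr) hab).1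
  exact (hdemon b a J hJ hba).2 I hI

section Entropy

variable {M : Set S.State} {Ent Ent₁ Ent₂ : Finset S.State → ℝ}

theorem IsEntropyU.pair (h : S.IsEntropyU M Ent) (a b : S.State) :
    Ent {S.pair a b} = Ent {a} + Ent {b} := by
  rw [← comb_singleton]
  exact h.1 _ _ (uniform_singleton a) (uniform_singleton b)

theorem IsEntropyU.statePow (h : S.IsEntropyU M Ent) (a : S.State) (n : ℕ) :
    Ent {statePow a n} = (n + 1) * Ent {a} := by
  induction n with
  | zero => simp [EidoSys.statePow]
  | succ n ih =>
    rw [EidoSys.statePow, h.pair, ih]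
    push_cast
    ring

theorem IsEntropyU.eq_of_rev (h : S.IsEntropyU M Ent) {E F : Finset S.State} (hE : S.Uniform E)
    (hF : S.Uniform F) (hEF : S.Rev E F) : Ent E = Ent F :=
  le_antisymm ((h.2.1 E F hE hF (Or.inl hEF.1)).1 hEF.1)
    ((h.2.1 F E hF hE (Or.inl hEF.2)).1 hEF.2)

theorem IsEntropyU.arrow_comb_iff (h : S.IsEntropyU M Ent) {a b : S.State} {I : Finset S.State}
    (hI : S.IsInfo I) (hpos : S.Pos {b} (S.comb {a} I)) :
    S.Arrow {b} (S.comb {a} I) ↔ Ent {b} - Ent {a} ≤ Real.logb 2 I.card := by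
  rw [h.2.1 _ _ (uniform_singleton b) (hI.uniform_comb a) hpos,
    h.1 _ _ (uniform_singleton a) hI.uniform, h.2.2.2 I hI, sub_le_iff_le_add']

/-- The entropy gain of a process `a → b` is measured by the same multiples against bits
in every entropy function. -/
theorem IsEntropyU.mul_sub_le_iff (hinfo : S.InfoAxiom) (hdemon : S.DemonAxiom)
    (h₁ : S.IsEntropyU M Ent₁) (h₂ : S.IsEntropyU M Ent₂) {a b : S.State}
    (hab : S.Arrow {a} {b}) (n k : ℕ) :
    ((n : ℝ) + 1) * (Ent₁ {b} - Ent₁ {a}) ≤ k + 1 ↔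
      ((n : ℝ) + 1) * (Ent₂ {b} - Ent₂ {a}) ≤ k + 1 := by
  obtain ⟨r, B, hr, hB, -⟩ := hinfo
  obtain ⟨I, hI, hcard⟩ := hB.exists_isInfo_card k
  have hpos := hdemon.pos_comb_of_arrow hr (arrow_statePow hab n) hI
  have hlog : Real.logb 2 I.card = k + 1 := by
    rw [hcard, Nat.cast_pow, Nat.cast_ofNat, Real.logb_pow, Real.logb_self_eq_one one_lt_two]
    simp
  have key := (h₁.arrow_comb_iff hI hpos).symm.trans (h₂.arrow_comb_iff hI hpos)
  simpa only [h₁.statePow, h₂.statePow, hlog, mul_sub] using key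

end Entropy

end EidoSys

theorem le_of_forall_nat_mul_le_imp {x y : ℝ} (hx : 0 ≤ x)
    (h : ∀ n k : ℕ, ((n : ℝ) + 1) * x ≤ k + 1 → ((n : ℝ) + 1) * y ≤ k + 1) : y ≤ x := by
  by_contra! hlt
  obtain ⟨n, hn⟩ := exists_nat_gt (1 / (y - x))
  rw [div_lt_iff₀ (sub_pos.2 hlt)] at hn
  have hle := h n ⌊((n : ℝ) + 1) * x⌋₊ (Nat.lt_floor_add_one _).le
  have hfloor := Nat.floor_le (show 0 ≤ ((n : ℝ) + 1) * x by positivity)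
  nlinarith

theorem EidoSys.IsEntropyU.sub_eq_sub {S : EidoSys} {M : Set S.State}
    {Ent₁ Ent₂ : Finset S.State → ℝ} (hinfo : S.InfoAxiom) (hdemon : S.DemonAxiom)
    (h₁ : S.IsEntropyU M Ent₁) (h₂ : S.IsEntropyU M Ent₂) {a b : S.State}
    (hab : S.Arrow {a} {b}) : Ent₁ {b} - Ent₁ {a} = Ent₂ {b} - Ent₂ {a} := by
  have nonneg {Ent : Finset S.State → ℝ} (h : S.IsEntropyU M Ent) : 0 ≤ Ent {b} - Ent {a} :=
    sub_nonneg.2 <|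
      (h.2.1 _ _ (uniform_singleton a) (uniform_singleton b) (Or.inl hab)).1 hab
  have hiff := h₁.mul_sub_le_iff hinfo hdemon h₂ hab
  exact le_antisymm (le_of_forall_nat_mul_le_imp (nonneg h₂) fun n k => (hiff n k).2)
    (le_of_forall_nat_mul_le_imp (nonneg h₁) fun n k => (hiff n k).1)

/-- Two entropy functions on the uniform eidostates determine the same entropic
probabilities: 2^{𝕊₁(a) − 𝕊₁(E)} = 2^{𝕊₂(a) − 𝕊₂(E)} for every uniform eidostate E and
every a ∈ E. -/
theorem stmt17 (S : EidoSys) (hinfo : S.InfoAxiom) (hdemon : S.DemonAxiom)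
    (hstab : S.StabilityAxiom) (hse : S.StateEquivAxiom)
    (M : Set S.State) (hM : S.MechSet M)
    (Ent₁ Ent₂ : Finset S.State → ℝ)
    (h₁ : S.IsEntropyU M Ent₁) (h₂ : S.IsEntropyU M Ent₂) :
    ∀ E : Finset S.State, S.Uniform E → ∀ a ∈ E,
      (2 : ℝ) ^ (Ent₁ {a} - Ent₁ E) = (2 : ℝ) ^ (Ent₂ {a} - Ent₂ E) := by
  intro E hE a ha
  obtain ⟨e, x, y, -, hrev⟩ := hse E hE
  have hax : S.Arrow {S.pair a x} {S.pair e y} := by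
    have hsub : ({S.pair a x} : Finset S.State) ⊆ S.comb E {x} := by
      simpa [EidoSys.comb] using ⟨a, ha, rfl⟩
    refine S.arrow_subset_single _ _ _ (hE.comb_state x).1 hsub
      (Finset.singleton_nonempty _) ?_
    simpa only [EidoSys.comb_singleton] using hrev.1
  have ent_eq {Ent : Finset S.State → ℝ} (h : S.IsEntropyU M Ent) :
      Ent E + Ent {x} = Ent {S.pair e y} := by
    rw [← h.1 _ _ hE (EidoSys.uniform_singleton x), ← EidoSys.comb_singleton]
    exact h.eq_of_rev (hE.comb_state x) ((EidoSys.uniform_singleton e).comb_state y) hrev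
  have hdiff := h₁.sub_eq_sub hinfo hdemon h₂ hax
  rw [h₁.pair a x, h₂.pair a x] at hdiff
  congr 1
  linarith [ent_eq h₁, ent_eq h₂]
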